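/- There do not exist five circles in the plane that are pairwise externally tangent: there are no points c₁, …, c₅ ∈ ℝ² and radii r₁, …, r₅ > 0 such that dist(cᵢ, cⱼ) = rᵢ + rⱼ for all i ≠ j. (Although the degree-of-freedom count N_F = 2N − N(N−1)/2 − 3 = −3 for N = 5 still leaves enough radii to adjust, this ultimate configuration of circles does not exist.) -/

import Mathlib

/-- Five vectors in `ℝ⁴` satisfy a nontrivial linear relation. -/
lemma exists_linear_relation_fin_five (u : Fin 5 → Fin 4 → ℝ) :
    ∃ a : Fin 5 → ℝ, (∀ k, ∑ i, a i * u i k = 0) ∧ ∃ i, a i ≠ 0 := by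
  have h : ¬ LinearIndependent ℝ u := fun h => by
    simpa using h.fintype_card_le_finrank
  obtain ⟨a, ha, hne⟩ := Fintype.not_linearIndependent_iff.mp h
  exact ⟨a, fun k => by simpa using congrFun ha k, hne⟩

/-- If `2 b j = ∑ i, b i` for all five indices `j`, then `b = 0`. -/
lemma eq_zero_of_two_mul_eq_sum {b : Fin 5 → ℝ} (h : ∀ j, 2 * b j = ∑ i, b i) (j : Fin 5) :
    b j = 0 := by
  have hsum : 2 * ∑ i, b i = 5 * ∑ i, b i := by
    conv_lhs => rw [Finset.mul_sum, Finset.sum_congr rfl fun i _ => h i]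
    simp
  linarith [h j]

/-- For externally tangent circles, the Lorentzian product of the vectors
`(x, y, 1, x² + y² - r²)` is minus the product of the radii. -/
lemma lorentz_product_of_tangent {p q : EuclideanSpace ℝ (Fin 2)} {r s : ℝ}
    (h : dist p q = r + s) :
    p 0 * q 0 + p 1 * q 1
      - ((p 0 ^ 2 + p 1 ^ 2 - r ^ 2) + (q 0 ^ 2 + q 1 ^ 2 - s ^ 2)) / 2 = -(r * s) := by
  have hsq : (p 0 - q 0) ^ 2 + (p 1 - q 1) ^ 2 = (r + s) ^ 2 := by
    rw [← h, EuclideanSpace.dist_eq, Real.sq_sqrt (by positivity)]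
    simp [Fin.sum_univ_two, Real.dist_eq, sq_abs]
  linarith

/-- There are no five pairwise externally tangent circles in the plane. -/
theorem stmt12 :
    ¬ ∃ (c : Fin 5 → EuclideanSpace ℝ (Fin 2)) (r : Fin 5 → ℝ),
        (∀ i, 0 < r i) ∧
        (∀ i j, i ≠ j → dist (c i) (c j) = r i + r j) := by
  rintro ⟨c, r, hr, hd⟩
  obtain ⟨a, ha, k, hk⟩ := exists_linear_relation_fin_five
    fun i => ![c i 0, c i 1, 1, c i 0 ^ 2 + c i 1 ^ 2 - r i ^ 2]
  have hx : ∑ i, a i * c i 0 = 0 := by simpa using ha 0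
  have hy : ∑ i, a i * c i 1 = 0 := by simpa using ha 1
  have hone : ∑ i, a i = 0 := by simpa using ha 2
  have hw : ∑ i, a i * (c i 0 ^ 2 + c i 1 ^ 2 - r i ^ 2) = 0 := by simpa using ha 3
  have hb : ∀ j, 2 * (a j * r j) = ∑ i, a i * r i := by
    intro j
    have hzero : ∑ i, a i * (c i 0 * c j 0 + c i 1 * c j 1
        - ((c i 0 ^ 2 + c i 1 ^ 2 - r i ^ 2) + (c j 0 ^ 2 + c j 1 ^ 2 - r j ^ 2)) / 2) = 0 := by
      calc _ = (∑ i, a i * c i 0) * c j 0 + (∑ i, a i * c i 1) * c j 1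
            - (∑ i, a i * (c i 0 ^ 2 + c i 1 ^ 2 - r i ^ 2)) / 2
            - (∑ i, a i) * ((c j 0 ^ 2 + c j 1 ^ 2 - r j ^ 2) / 2) := by
            simp only [Finset.sum_mul, Finset.sum_div, ← Finset.sum_add_distrib,
              ← Finset.sum_sub_distrib]
            exact Finset.sum_congr rfl fun i _ => by ring
        _ = 0 := by rw [hx, hy, hone, hw]; ring
    have hgram : ∀ i, a i * (c i 0 * c j 0 + c i 1 * c j 1
        - ((c i 0 ^ 2 + c i 1 ^ 2 - r i ^ 2) + (c j 0 ^ 2 + c j 1 ^ 2 - r j ^ 2)) / 2)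
        = (if i = j then 2 * (a j * r j) * r j else 0) - a i * r i * r j := by
      intro i
      split_ifs with hij
      · subst hij; ring
      · rw [lorentz_product_of_tangent (hd i j hij)]; ring
    rw [Finset.sum_congr rfl fun i _ => hgram i, Finset.sum_sub_distrib, ← Finset.sum_mul] at hzero
    simp only [Finset.sum_ite_eq', Finset.mem_univ, if_true] at hzero
    exact mul_right_cancel₀ (hr j).ne' (sub_eq_zero.mp hzero)
  exact mul_ne_zero hk (hr k).ne' (eq_zero_of_two_mul_eq_sum hb k)
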